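/- Let G be a finite group, H ≤ G, and S ⊆ G with S = HSH and S ∩ H = ∅. Let K be maximal among subgroups of G containing H such that S = KSK, let 𝒞 be the set of left cosets of H in G, let ℬ/𝒞 be the block system of Aut(Cos(G,H,S)) on G/H whose blocks are the sets of left cosets of H contained in a single left coset of K, and let k = |K|. Then Aut(Cay(G,S)) ≅ (Aut(Cos(G,H,S))/(ℬ/𝒞)) ≀ S_k, the wreath product of the induced action of Aut(Cos(G,H,S)) on ℬ/𝒞 with the symmetric group of degree k. -/

import Mathlib

open scoped Pointwise

namespace DCG

/-- An isomorphism of digraphs: a bijection of vertex sets mapping arcs to arcs and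
non-arcs to non-arcs. -/
structure Iso {V W : Type*} (Γ₁ : Digraph V) (Γ₂ : Digraph W) extends V ≃ W where
  adj_iff : ∀ u v : V, Γ₂.Adj (toEquiv u) (toEquiv v) ↔ Γ₁.Adj u v

/-- The wreath product of two digraphs. -/
def wr {V₁ V₂ : Type*} (Γ₁ : Digraph V₁) (Γ₂ : Digraph V₂) : Digraph (V₁ × V₂) where
  Adj p q := Γ₁.Adj p.1 q.1 ∨ (p.1 = q.1 ∧ Γ₂.Adj p.2 q.2)

/-- The automorphism group of a digraph, as a subgroup of the symmetric group on the
vertices. -/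
def Aut {V : Type*} (Γ : Digraph V) : Subgroup (Equiv.Perm V) where
  carrier := {e | ∀ u v : V, Γ.Adj (e u) (e v) ↔ Γ.Adj u v}
  one_mem' := by intro u v; rfl
  mul_mem' := by
    intro a b ha hb u v
    simpa [Equiv.Perm.mul_apply] using ((ha (b u) (b v)).trans (hb u v))
  inv_mem' := by
    intro a ha u v
    simpa using (ha (a⁻¹ u) (a⁻¹ v)).symm

/-- A subgroup of the symmetric group is transitive. -/
def IsTransitiveSub {V : Type*} (A : Subgroup (Equiv.Perm V)) : Prop :=
  ∀ u v : V, ∃ g ∈ A, (g : Equiv.Perm V) u = v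

/-- A digraph is vertex-transitive when its automorphism group is transitive. -/
def IsVertexTransitive {V : Type*} (Γ : Digraph V) : Prop :=
  IsTransitiveSub (Aut Γ)

/-- `ℬ` is a block system of the permutation group `A`: an `A`-invariant partition of the
point set. -/
def IsBlockSystemOf {V : Type*} (A : Subgroup (Equiv.Perm V)) (ℬ : Set (Set V)) : Prop :=
  Setoid.IsPartition ℬ ∧ ∀ g ∈ A, ∀ B ∈ ℬ, (g : Equiv.Perm V) '' B ∈ ℬ

/-- The block quotient digraph of `Γ` with respect to a set `ℬ` of sets of vertices. -/
def quotDgr {V : Type*} (Γ : Digraph V) (ℬ : Set (Set V)) : Digraph ℬ where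
  Adj B B' := B ≠ B' ∧ ∃ x ∈ (B : Set V), ∃ y ∈ (B' : Set V), Γ.Adj x y

/-- The subdigraph of `Γ` induced on a set `B` of vertices. -/
def induce {V : Type*} (Γ : Digraph V) (B : Set V) : Digraph B where
  Adj x y := Γ.Adj (x : V) (y : V)

/-- The double coset digraph `Cos(G,H,S)`. -/
def cos (G : Type*) [Group G] (H : Subgroup G) (S : Set G) : Digraph (G ⧸ H) where
  Adj a b := ∃ g s : G, s ∈ S ∧ a = QuotientGroup.mk g ∧ b = QuotientGroup.mk (g * s)

/-- The Cayley digraph `Cay(G,S)`. -/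
def cay (G : Type*) [Group G] (S : Set G) : Digraph G where
  Adj a b := ∃ s ∈ S, b = a * s

/-- The digraph on `n` vertices with no arcs. -/
def empt (n : ℕ) : Digraph (Fin n) where
  Adj _ _ := False

/-- The wreath product of two permutation groups, in its imprimitive action. -/
def permWr {X Y : Type*} (A : Subgroup (Equiv.Perm X)) (B : Subgroup (Equiv.Perm Y)) :
    Subgroup (Equiv.Perm (X × Y)) where
  carrier := {e | ∃ g ∈ A, ∃ h : X → Equiv.Perm Y, (∀ x, h x ∈ B) ∧
    ∀ p : X × Y, e p = (g p.1, h p.1 p.2)}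
  one_mem' := ⟨1, A.one_mem, fun _ => 1, fun _ => B.one_mem, fun _ => rfl⟩
  mul_mem' := by
    rintro a b ⟨g₁, hg₁, h₁, hh₁, he₁⟩ ⟨g₂, hg₂, h₂, hh₂, he₂⟩
    refine ⟨g₁ * g₂, A.mul_mem hg₁ hg₂, fun x => h₁ (g₂ x) * h₂ x,
      fun x => B.mul_mem (hh₁ _) (hh₂ _), fun p => ?_⟩
    simp [Equiv.Perm.mul_apply, he₁, he₂]
  inv_mem' := by
    rintro a ⟨g, hg, h, hh, he⟩
    refine ⟨g⁻¹, A.inv_mem hg, fun x => (h (g⁻¹ x))⁻¹,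
      fun x => B.inv_mem (hh _), fun p => ?_⟩
    have key : a (g⁻¹ p.1, (h (g⁻¹ p.1))⁻¹ p.2) = p := by
      rw [he]
      simp [Equiv.Perm.mul_apply]
    calc a⁻¹ p = a⁻¹ (a (g⁻¹ p.1, (h (g⁻¹ p.1))⁻¹ p.2)) := by rw [key]
    _ = (g⁻¹ p.1, (h (g⁻¹ p.1))⁻¹ p.2) := by simp

/-- The induced action of a permutation group `A` on a system `ℬ` of sets of points,
as a subgroup of the symmetric group on `ℬ`. -/
def inducedOn {X : Type*} (A : Subgroup (Equiv.Perm X)) (ℬ : Set (Set X)) :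
    Subgroup (Equiv.Perm ℬ) where
  carrier := {σ | ∃ g ∈ A, ∀ B : ℬ, ((σ B : Set X)) = (g : Equiv.Perm X) '' (B : Set X)}
  one_mem' := ⟨1, A.one_mem, by simp⟩
  mul_mem' := by
    rintro a b ⟨g₁, hg₁, h₁⟩ ⟨g₂, hg₂, h₂⟩
    refine ⟨g₁ * g₂, A.mul_mem hg₁ hg₂, fun B => ?_⟩
    have : ((a * b) B : Set X) = (a (b B) : Set X) := rfl
    rw [this, h₁, h₂]
    ext x
    simp [Equiv.Perm.mul_apply, Set.image_image]
  inv_mem' := by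
    rintro a ⟨g, hg, h⟩
    refine ⟨g⁻¹, A.inv_mem hg, fun B => ?_⟩
    have hb : ((a (a⁻¹ B)) : Set X) = (g : Equiv.Perm X) '' ((a⁻¹ B : ℬ) : Set X) := h _
    have hab : a (a⁻¹ B) = B := by simp
    rw [hab] at hb
    rw [hb]
    ext x
    simp

/-- A digraph is complete if every ordered pair of distinct vertices is an arc. -/
def IsComplete {V : Type*} (Γ : Digraph V) : Prop := ∀ u v : V, u ≠ v → Γ.Adj u v

/-- A digraph has no arcs. -/
def HasNoArcs {V : Type*} (Γ : Digraph V) : Prop := ∀ u v : V, ¬ Γ.Adj u v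

/-- A digraph is reducible if two distinct vertices have the same out-neighbours and the
same in-neighbours. -/
def Reducible {V : Type*} (Γ : Digraph V) : Prop :=
  ∃ u v : V, u ≠ v ∧ (∀ w, Γ.Adj u w ↔ Γ.Adj v w) ∧ (∀ w, Γ.Adj w u ↔ Γ.Adj w v)

/-- A regular subgroup of a symmetric group: transitive, and only the identity fixes a
point. -/
def IsRegularSub {X : Type*} [Nonempty X] (L : Subgroup (Equiv.Perm X)) : Prop :=
  IsTransitiveSub L ∧ ∀ g ∈ L, (∃ x : X, (g : Equiv.Perm X) x = x) → g = 1

/-- A block system for a multiplicative action: an invariant partition. -/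
def IsBlockSystemMul (G : Type*) [Group G] {X : Type*} [MulAction G X]
    (ℬ : Set (Set X)) : Prop :=
  Setoid.IsPartition ℬ ∧ ∀ (g : G), ∀ B ∈ ℬ, g • B ∈ ℬ

/-- `Γ` is isomorphic to a nontrivial wreath product of two vertex-transitive digraphs,
each with at least two vertices. -/
def IsNontrivialWreathProduct {V : Type*} (Γ : Digraph V) : Prop :=
  ∃ (V₁ V₂ : Type) (Γ₁ : Digraph V₁) (Γ₂ : Digraph V₂),
    IsVertexTransitive Γ₁ ∧ IsVertexTransitive Γ₂ ∧
    2 ≤ Nat.card V₁ ∧ 2 ≤ Nat.card V₂ ∧ Nonempty (Iso Γ (wr Γ₁ Γ₂))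

/-- The block quotient of a digraph on `G` by the partition of `G` into left cosets
of `H`, realized on the vertex set `G ⧸ H`. -/
def cosetQuot (G : Type*) [Group G] (H : Subgroup G) (Γ : Digraph G) : Digraph (G ⧸ H) where
  Adj a b := a ≠ b ∧ ∃ x y : G, (QuotientGroup.mk x : G ⧸ H) = a ∧
    (QuotientGroup.mk y : G ⧸ H) = b ∧ Γ.Adj x y

theorem exists_equiv_prod_of_isPretransitive {G V X : Type*} [Group G] [MulAction G V]
    [MulAction.IsPretransitive G V] (p : V → X) (hp : Function.Surjective p)
    (hsmul : ∀ (g : G) (u v : V), p (g • u) = p (g • v) ↔ p u = p v) (v₀ : V) :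
    ∃ e : V ≃ X × {v // p v = p v₀}, ∀ v, (e v).1 = p v := by
  have fiber : ∀ x : X, Nonempty ({v // p v = x} ≃ {v // p v = p v₀}) := by
    intro x
    obtain ⟨v, rfl⟩ := hp x
    obtain ⟨g, rfl⟩ := MulAction.exists_smul_eq G v₀ v
    exact ⟨((MulAction.toPerm g).subtypeEquiv fun u => (hsmul g u v₀).symm).symm⟩
  exact ⟨(Equiv.sigmaFiberEquiv p).symm.trans
    ((Equiv.sigmaCongrRight fun x => (fiber x).some).trans (Equiv.sigmaEquivProd _ _)),
    fun _ => rfl⟩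

theorem exists_mem_Aut_of_semiconj {V X : Type*} {Γ : Digraph V} {D : Digraph X} {p : V → X}
    (hp : Function.Surjective p) (hadj : ∀ u v, Γ.Adj u v ↔ D.Adj (p u) (p v))
    (hD : ∀ x y, (∀ w, D.Adj x w ↔ D.Adj y w) → (∀ w, D.Adj w x ↔ D.Adj w y) → x = y)
    {a : Equiv.Perm V} (ha : a ∈ Aut Γ) :
    ∃ σ ∈ Aut D, ∀ u, p (a u) = σ (p u) := by
  have imp : ∀ b ∈ Aut Γ, ∀ u v, p u = p v → p (b u) = p (b v) := by
    intro b hb u v huv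
    apply hD <;> intro w <;> obtain ⟨w, rfl⟩ := hp w <;>
      obtain ⟨w, rfl⟩ := b.surjective w <;>
      rw [← hadj, ← hadj, hb, hb, hadj, hadj, huv]
  have iff : ∀ u v, p (a u) = p (a v) ↔ p u = p v := by
    refine fun u v => ⟨fun h => ?_, imp a ha u v⟩
    simpa using imp a⁻¹ (inv_mem ha) _ _ h
  have hs := Function.surjInv_eq hp
  have key : ∀ u, p (a (Function.surjInv hp (p u))) = p (a u) := fun u => (iff _ _).2 (hs _)
  have inj : Function.Injective fun x => p (a (Function.surjInv hp x)) := fun x y h =>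
    (hs x).symm.trans (((iff _ _).1 h).trans (hs y))
  have surj : Function.Surjective fun x => p (a (Function.surjInv hp x)) := by
    intro y
    obtain ⟨v, rfl⟩ := hp y
    obtain ⟨u, rfl⟩ := a.surjective v
    exact ⟨p u, key u⟩
  obtain ⟨σ, hσ⟩ : ∃ σ : Equiv.Perm X, ∀ u, σ (p u) = p (a u) :=
    ⟨Equiv.ofBijective _ ⟨inj, surj⟩, key⟩
  refine ⟨σ, fun x y => ?_, fun u => (hσ u).symm⟩
  obtain ⟨u, rfl⟩ := hp x
  obtain ⟨v, rfl⟩ := hp y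
  rw [hσ, hσ, ← hadj, ← hadj, ha]

/-- The automorphism group of a digraph with independent twin classes of constant size is a
wreath product. -/
theorem map_Aut_eq_permWr {V X Y : Type*} [Nonempty Y] {Γ : Digraph V} {D : Digraph X}
    (e : V ≃ X × Y) (hadj : ∀ u v, Γ.Adj u v ↔ D.Adj (e u).1 (e v).1)
    (hD : ∀ x y, (∀ w, D.Adj x w ↔ D.Adj y w) → (∀ w, D.Adj w x ↔ D.Adj w y) → x = y) :
    (Aut Γ).map (e.permCongrHom : Equiv.Perm V →* Equiv.Perm (X × Y)) = permWr (Aut D) ⊤ := by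
  have hp : Function.Surjective fun v => (e v).1 := Prod.fst_surjective.comp e.surjective
  ext b
  constructor
  · rintro ⟨a, ha, rfl⟩
    obtain ⟨σ, hσ, h⟩ := exists_mem_Aut_of_semiconj hp hadj hD ha
    have h' : ∀ q, (e (a (e.symm q))).1 = σ q.1 := fun q => by simpa using h (e.symm q)
    refine ⟨σ, hσ, fun x => Equiv.ofBijective (fun y => (e (a (e.symm (x, y)))).2) ⟨?_, ?_⟩,
      fun _ => Subgroup.mem_top _, fun q => Prod.ext (h' q) rfl⟩
    · intro y z hyz
      have := Prod.ext ((h' (x, y)).trans (h' (x, z)).symm) hyz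
      simpa using this
    · intro z
      obtain ⟨u, hu⟩ := (e.symm.trans (a.trans e)).surjective (σ x, z)
      obtain ⟨x', y⟩ := u
      have hx : x' = x := σ.injective (by
        rw [← h' (x', y)]
        exact congrArg Prod.fst hu)
      subst hx
      exact ⟨y, congrArg Prod.snd hu⟩
  · rintro ⟨σ, hσ, h, -, hb⟩
    refine ⟨e.permCongrHom.symm b, fun u v => ?_, e.permCongrHom.apply_symm_apply b⟩
    rw [hadj, hadj, ← hσ (e u).1]
    simp [Equiv.permCongrHom, Equiv.permCongr_apply, hb]

theorem inducedOn_Aut_eq {V Z : Type*} {ℬ : Set (Set V)} {Γ : Digraph V} {D : Digraph ℬ}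
    {p : V → ℬ} (hp : Function.Surjective p) (hmem : ∀ v (B : ℬ), v ∈ (B : Set V) ↔ p v = B)
    (e : V ≃ ℬ × Z) (he : ∀ v, (e v).1 = p v) (hadj : ∀ u v, Γ.Adj u v ↔ D.Adj (p u) (p v)) :
    inducedOn (Aut Γ) ℬ = Aut D := by
  ext σ
  constructor
  · rintro ⟨g, hg, h⟩ x y
    have hσ : ∀ u, σ (p u) = p (g u) := fun u =>
      ((hmem _ _).1 (h (p u) ▸ Set.mem_image_of_mem g ((hmem u _).2 rfl))).symm
    obtain ⟨u, rfl⟩ := hp x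
    obtain ⟨v, rfl⟩ := hp y
    rw [hσ, hσ, ← hadj, ← hadj, hg]
  · intro hσ
    let g : Equiv.Perm V := e.trans ((Equiv.prodCongr σ (Equiv.refl Z)).trans e.symm)
    have hg : ∀ u, p (g u) = σ (p u) := fun u => by simp [g, ← he]
    refine ⟨g, fun u v => by rw [hadj, hadj, hg, hg, hσ], fun B => Set.ext fun v => ?_⟩
    obtain ⟨u, rfl⟩ := g.surjective v
    rw [hmem, hg, σ.injective.eq_iff, g.injective.mem_set_image, hmem]

theorem mul_mem_iff_of_mul_mul_eq {G : Type*} [Group G] {K : Subgroup G} {S : Set G}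
    (hK : (K : Set G) * S * (K : Set G) = S) {k l : G} (hk : k ∈ K) (hl : l ∈ K) (s : G) :
    k * s * l ∈ S ↔ s ∈ S := by
  have imp : ∀ {k l s : G}, k ∈ K → l ∈ K → s ∈ S → k * s * l ∈ S := fun hk hl hs =>
    hK ▸ Set.mul_mem_mul (Set.mul_mem_mul hk hs) hl
  refine ⟨fun h => ?_, imp hk hl⟩
  simpa [mul_assoc] using imp (inv_mem hk) (inv_mem hl) h

/-- A subgroup that is maximal among the `K` with `K * S * K = S` contains every element whose
left and right translations both stabilize `S`. -/
theorem mem_of_maximal_of_forall_mul_mem_iff {G : Type*} [Group G] {H K : Subgroup G} {S : Set G}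
    (hHK : H ≤ K) (hK : (K : Set G) * S * (K : Set G) = S)
    (hmax : ∀ K' : Subgroup G, H ≤ K' → (K' : Set G) * S * (K' : Set G) = S → ¬ K < K')
    {x : G} (hl : ∀ s, x * s ∈ S ↔ s ∈ S) (hr : ∀ s, s * x ∈ S ↔ s ∈ S) : x ∈ K := by
  let L : Subgroup G :=
    { carrier := {x | ∀ s, (x * s ∈ S ↔ s ∈ S) ∧ (s * x ∈ S ↔ s ∈ S)}
      one_mem' := by simp
      mul_mem' := fun {a b} ha hb s =>
        ⟨by rw [mul_assoc, (ha _).1, (hb _).1], by rw [← mul_assoc, (hb _).2, (ha _).2]⟩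
      inv_mem' := fun {a} ha s =>
        ⟨by rw [← (ha _).1, mul_inv_cancel_left], by rw [← (ha _).2, inv_mul_cancel_right]⟩ }
  have hKL : K ≤ L := fun k hk s =>
    ⟨by simpa using mul_mem_iff_of_mul_mul_eq hK hk (one_mem K) s,
      by simpa using mul_mem_iff_of_mul_mul_eq hK (one_mem K) hk s⟩
  have hL : (L : Set G) * S * (L : Set G) = S := by
    ext s
    constructor
    · rintro ⟨_, ⟨a, ha, t, ht, rfl⟩, b, hb, rfl⟩
      exact (hb _).2.2 ((ha _).1.2 ht)
    · exact fun hs => ⟨s, ⟨1, one_mem L, s, hs, one_mul s⟩, 1, one_mem L, mul_one s⟩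
  by_contra hx
  exact hmax L (hHK.trans hKL) hL (lt_of_le_of_ne hKL fun h => hx (h ▸ fun s => ⟨hl s, hr s⟩))

theorem cay_adj_iff {G : Type*} [Group G] {S : Set G} {a b : G} :
    (cay G S).Adj a b ↔ a⁻¹ * b ∈ S := by
  constructor
  · rintro ⟨s, hs, rfl⟩
    simpa using hs
  · exact fun h => ⟨_, h, by simp⟩

theorem cos_adj_mk_iff {G : Type*} [Group G] {H : Subgroup G} {S : Set G}
    (hS : (H : Set G) * S * (H : Set G) = S) {a b : G} :
    (cos G H S).Adj (a : G ⧸ H) (b : G ⧸ H) ↔ a⁻¹ * b ∈ S := by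
  constructor
  · rintro ⟨g, s, hs, hg, hb⟩
    rw [QuotientGroup.eq] at hg hb
    rw [← mul_mem_iff_of_mul_mul_eq hS (inv_mem hg) hb]
    simpa [mul_assoc] using hs
  · exact fun h => ⟨a, _, h, rfl, by simp⟩

/-- If `K` is maximal among subgroups of `G` containing `H` with `S = KSK`,
`ℬ/𝒞` is the block system of `Aut(Cos(G,H,S))` on `G/H` whose blocks are the sets of left
cosets of `H` contained in a single left coset of `K`, and `k = |K|`, then
`Aut(Cay(G,S)) ≅ (Aut(Cos(G,H,S))/(ℬ/𝒞)) ≀ S_k`. -/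
theorem statement_15 {G : Type*} [Group G] [Finite G] (H K : Subgroup G) (S : Set G)
    (hS : (H : Set G) * S * (H : Set G) = S) (hdisj : S ∩ (H : Set G) = ∅)
    (hHK : H ≤ K) (hK : (K : Set G) * S * (K : Set G) = S)
    (hmax : ∀ K' : Subgroup G, H ≤ K' → (K' : Set G) * S * (K' : Set G) = S → ¬ K < K') :
    Nonempty ((Aut (cay G S)) ≃*
      (permWr (inducedOn (Aut (cos G H S))
          {B : Set (G ⧸ H) | ∃ g : G, B = (QuotientGroup.mk : G → G ⧸ H) '' (g • (K : Set G))})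
        (⊤ : Subgroup (Equiv.Perm (Fin (Nat.card K)))))) := by
  set ℬ : Set (Set (G ⧸ H)) :=
    {B | ∃ g : G, B = (QuotientGroup.mk : G → G ⧸ H) '' (g • (K : Set G))} with hℬ
  let q : G → ℬ := fun g => ⟨(QuotientGroup.mk : G → G ⧸ H) '' (g • (K : Set G)), g, rfl⟩
  have hq : Function.Surjective q := by
    rintro ⟨_, g, rfl⟩
    exact ⟨g, rfl⟩
  have mem_q : ∀ a b : G, (a : G ⧸ H) ∈ (q b : Set (G ⧸ H)) ↔ b⁻¹ * a ∈ K := by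
    intro a b
    constructor
    · rintro ⟨c, hc, hca⟩
      rw [QuotientGroup.eq] at hca
      rw [Set.mem_smul_set_iff_inv_smul_mem] at hc
      simpa [mul_assoc] using K.mul_mem hc (hHK hca)
    · exact fun h => ⟨a, Set.mem_smul_set_iff_inv_smul_mem.2 h, rfl⟩
  have q_eq : ∀ a b : G, q a = q b ↔ b⁻¹ * a ∈ K := by
    intro a b
    constructor
    · intro h
      rw [← mem_q, ← h, mem_q]
      simp
    · intro h
      refine Subtype.ext (Set.ext fun x => ?_)
      induction x using QuotientGroup.induction_on with | H c => ?_
      rw [mem_q, mem_q, ← K.mul_mem_cancel_left h]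
      simp [mul_assoc]
  let p : G ⧸ H → ℬ := fun x => Quotient.liftOn' x q fun a b h => by
    rw [QuotientGroup.leftRel_apply] at h
    exact ((q_eq b a).2 (hHK h)).symm
  have p_mk : ∀ a : G, p a = q a := fun _ => rfl
  have hp : Function.Surjective p := fun B => (hq B).imp' _ fun a h => (p_mk a).trans h
  let D : Digraph ℬ := ⟨fun x y => ∃ a b, q a = x ∧ q b = y ∧ a⁻¹ * b ∈ S⟩
  have hD : ∀ a b, D.Adj (q a) (q b) ↔ a⁻¹ * b ∈ S := by
    refine fun a b => ⟨?_, fun h => ⟨a, b, rfl, rfl, h⟩⟩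
    rintro ⟨c, d, hc, hd, h⟩
    rw [eq_comm, q_eq] at hd
    rw [q_eq] at hc
    have := (mul_mem_iff_of_mul_mul_eq hK hc hd _).2 h
    simpa [mul_assoc] using this
  have hcay : ∀ a b, (cay G S).Adj a b ↔ D.Adj (q a) (q b) := fun a b => by
    rw [cay_adj_iff, hD]
  have hcos : ∀ x y, (cos G H S).Adj x y ↔ D.Adj (p x) (p y) := by
    intro x y
    induction x using QuotientGroup.induction_on with | H a => ?_
    induction y using QuotientGroup.induction_on with | H b => ?_
    rw [cos_adj_mk_iff hS, p_mk, p_mk, hD]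
  have hirr : ∀ x y, (∀ w, D.Adj x w ↔ D.Adj y w) → (∀ w, D.Adj w x ↔ D.Adj w y) → x = y := by
    intro x y hout hin
    obtain ⟨a, rfl⟩ := hq x
    obtain ⟨b, rfl⟩ := hq y
    rw [q_eq]
    refine mem_of_maximal_of_forall_mul_mem_iff hHK hK hmax (fun s => ?_) fun s => ?_
    · simpa [hD, mul_assoc] using (hout (q (a * s))).symm
    · simpa [hD, mul_assoc] using hin (q (b * s⁻¹))
  have hmem : ∀ x (B : ℬ), x ∈ (B : Set (G ⧸ H)) ↔ p x = B := by
    intro x B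
    induction x using QuotientGroup.induction_on with | H a => ?_
    obtain ⟨b, rfl⟩ := hq B
    rw [mem_q, p_mk, q_eq]
  obtain ⟨e, he⟩ := exists_equiv_prod_of_isPretransitive (G := G) q hq
    (fun g u v => by simp [q_eq, mul_assoc]) 1
  obtain ⟨e', he'⟩ := exists_equiv_prod_of_isPretransitive (G := G) p hp (fun g x y => by
    induction x using QuotientGroup.induction_on with | H a => ?_
    induction y using QuotientGroup.induction_on with | H b => ?_
    rw [MulAction.Quotient.smul_coe, MulAction.Quotient.smul_coe]
    simp [p_mk, q_eq, mul_assoc]) ((1 : G) : G ⧸ H)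
  let f : {g // q g = q 1} ≃ Fin (Nat.card K) :=
    (Equiv.subtypeEquivRight fun g => by simp [q_eq]).trans (Finite.equivFin K)
  let e₁ : G ≃ ℬ × Fin (Nat.card K) := e.trans (Equiv.prodCongr (Equiv.refl ℬ) f)
  have he₁ : ∀ a, (e₁ a).1 = q a := he
  have : Nonempty (Fin (Nat.card K)) := ⟨f ⟨1, rfl⟩⟩
  rw [inducedOn_Aut_eq hp hmem e' he' hcos, ← map_Aut_eq_permWr e₁ (by simpa [he₁] using hcay) hirr]
  exact ⟨e₁.permCongrHom.subgroupMap (Aut (cay G S))⟩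

end DCG
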